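/- Let (Ω,F,P) be a non-atomic probability space, G ⊆ F a sub-σ-algebra, u1, u2 ∈ U⁺_icx, α ∈ (0,1) and X ∈ L∞(F). Then the conditional generalized quantile satisfies ρ_α^G(X) = ρ_v^G(X) P-a.s., where ρ_v^G is the conditional shortfall risk measure associated with the increasing function v defined by v(x) = α·(u1)'_−(x) for x > 0 and v(x) = −(1−α)·(u2)'_+(−x) for x ≤ 0, with (u1)'_− the left derivative of u1 and (u2)'_+ the right derivative of u2. -/

import Mathlib

open MeasureTheory Set Filter Topology

variable {Ω : Type*}

/-- `Z ∈ L∞(𝒢)`: `Z` is `𝒢`-measurable and bounded. -/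
def BddMeas (𝒢 : MeasurableSpace Ω) (Z : Ω → ℝ) : Prop :=
  Measurable[𝒢] Z ∧ ∃ C : ℝ, ∀ ω, |Z ω| ≤ C

/-- `u ∈ U⁺_icx`: `u` is strictly increasing and convex on `[0,∞)` with `u 0 = 0`, `u 1 = 1`. -/
def Uicx (u : ℝ → ℝ) : Prop :=
  StrictMonoOn u (Set.Ici 0) ∧ ConvexOn ℝ (Set.Ici 0) u ∧ u 0 = 0 ∧ u 1 = 1

/-- `π_α(X,Z) = α·E[u1((X−Z)⁺)] + (1−α)·E[u2((X−Z)⁻)]`. -/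
noncomputable def piRisk {mΩ : MeasurableSpace Ω} (P : Measure Ω) (u1 u2 : ℝ → ℝ) (α : ℝ)
    (X Z : Ω → ℝ) : ℝ :=
  α * ∫ ω, u1 (max (X ω - Z ω) 0) ∂P + (1 - α) * ∫ ω, u2 (max (Z ω - X ω) 0) ∂P

/-- The set of minimizers of `Z ↦ π_α(X,Z)` over `L∞(𝒢)`. -/
def ArgminSet {mΩ : MeasurableSpace Ω} (P : Measure Ω) (𝒢 : MeasurableSpace Ω)
    (u1 u2 : ℝ → ℝ) (α : ℝ) (X : Ω → ℝ) : Set (Ω → ℝ) :=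
  {Z | BddMeas 𝒢 Z ∧ ∀ W, BddMeas 𝒢 W → piRisk P u1 u2 α X Z ≤ piRisk P u1 u2 α X W}

/-- `ρ` is an essential infimum of the family `S` of random variables in the a.s. order. -/
def IsEssInf {mΩ : MeasurableSpace Ω} (P : Measure Ω) (S : Set (Ω → ℝ)) (ρ : Ω → ℝ) : Prop :=
  (∀ Z ∈ S, ρ ≤ᵐ[P] Z) ∧ ∀ W : Ω → ℝ, (∀ Z ∈ S, W ≤ᵐ[P] Z) → W ≤ᵐ[P] ρ

/-- The probability space is non-atomic. -/
def Nonatomic {mΩ : MeasurableSpace Ω} (P : Measure Ω) : Prop :=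
  ∀ A : Set Ω, MeasurableSet[mΩ] A → 0 < P A →
    ∃ B ⊆ A, MeasurableSet[mΩ] B ∧ 0 < P B ∧ P B < P A

/-- The acceptance set of the conditional shortfall risk measure:
`{Z ∈ L∞(𝒢) : E[v(X−Z)|𝒢] ≤ 0 a.s.}`. -/
def ShortfallSet {mΩ : MeasurableSpace Ω} (P : Measure Ω) (𝒢 : MeasurableSpace Ω)
    (v : ℝ → ℝ) (X : Ω → ℝ) : Set (Ω → ℝ) :=
  {Z | BddMeas 𝒢 Z ∧ ∀ᵐ ω ∂P, (P[fun ω' => v (X ω' - Z ω')|𝒢]) ω ≤ 0}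

/-- Left derivative of `u` at `x`, multiplied by the indicator of `{x > 0}`. -/
noncomputable def ldInd (u : ℝ → ℝ) (x : ℝ) : ℝ :=
  if 0 < x then derivWithin u (Set.Iic x) x else 0

/-- Right derivative of `u` at `x`, multiplied by the indicator of `{x ≥ 0}`. -/
noncomputable def rdInd (u : ℝ → ℝ) (x : ℝ) : ℝ :=
  if 0 ≤ x then derivWithin u (Set.Ici x) x else 0

/-- The function `v` built from `u1, u2, α`: `v(x) = α·(u1)'_−(x)` for `x > 0` and
`v(x) = −(1−α)·(u2)'_+(−x)` for `x ≤ 0`. -/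
noncomputable def vFun (u1 u2 : ℝ → ℝ) (α : ℝ) (x : ℝ) : ℝ :=
  if 0 < x then α * derivWithin u1 (Set.Iic x) x
  else -((1 - α) * derivWithin u2 (Set.Ici (-x)) (-x))

/-- `ρ` is a conditional convex risk measure: monotone, conditionally translation
invariant, conditionally convex and normalized. -/
def IsCondConvexRM {mΩ : MeasurableSpace Ω} (P : Measure Ω) (𝒢 : MeasurableSpace Ω)
    (ρ : (Ω → ℝ) → (Ω → ℝ)) : Prop :=
  (∀ X Y : Ω → ℝ, BddMeas mΩ X → BddMeas mΩ Y → X ≤ᵐ[P] Y → ρ X ≤ᵐ[P] ρ Y) ∧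
  (∀ X Z : Ω → ℝ, BddMeas mΩ X → BddMeas 𝒢 Z →
      ρ (fun ω => X ω + Z ω) =ᵐ[P] fun ω => ρ X ω + Z ω) ∧
  (∀ X Y Λ : Ω → ℝ, BddMeas mΩ X → BddMeas mΩ Y → BddMeas 𝒢 Λ →
      (∀ᵐ ω ∂P, 0 ≤ Λ ω ∧ Λ ω ≤ 1) →
      ρ (fun ω => Λ ω * X ω + (1 - Λ ω) * Y ω) ≤ᵐ[P]
        fun ω => Λ ω * ρ X ω + (1 - Λ ω) * ρ Y ω) ∧
  (ρ (fun _ => 0) =ᵐ[P] fun _ => 0)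

/-- `ρ` is a conditional coherent risk measure: a conditional convex risk measure that is
conditionally positively homogeneous. -/
def IsCondCoherentRM {mΩ : MeasurableSpace Ω} (P : Measure Ω) (𝒢 : MeasurableSpace Ω)
    (ρ : (Ω → ℝ) → (Ω → ℝ)) : Prop :=
  IsCondConvexRM P 𝒢 ρ ∧
  ∀ X Λ : Ω → ℝ, BddMeas mΩ X → BddMeas 𝒢 Λ → (∀ᵐ ω ∂P, 0 ≤ Λ ω) →
    ρ (fun ω => Λ ω * X ω) =ᵐ[P] fun ω => Λ ω * ρ X ω

/-- `𝒢` is generated by a finite measurable partition of `Ω`, each cell having positive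
probability. -/
def FinitePartitionGen {mΩ : MeasurableSpace Ω} (P : Measure Ω)
    (𝒢 : MeasurableSpace Ω) : Prop :=
  ∃ (n : ℕ) (A : Fin n → Set Ω),
    (∀ i, MeasurableSet[mΩ] (A i)) ∧ (∀ i, 0 < P (A i)) ∧
    Pairwise (Function.onFun Disjoint A) ∧ (⋃ i, A i) = Set.univ ∧
    𝒢 = MeasurableSpace.generateFrom {s | ∃ i, s = A i}

/-- The loss function `f(x) = α u1(x⁺) + (1-α) u2(x⁻)`. -/
noncomputable def lossF (u1 u2 : ℝ → ℝ) (α x : ℝ) : ℝ :=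
  α * u1 (max x 0) + (1 - α) * u2 (max (-x) 0)

theorem Uicx.mono_pos {u : ℝ → ℝ} (h : Uicx u) : Monotone (fun x => u (max x 0)) := by
  intro x y hxy
  exact h.1.monotoneOn (by simp) (by simp) (max_le_max_right 0 hxy)

theorem Uicx.convex_pos {u : ℝ → ℝ} (h : Uicx u) :
    ConvexOn ℝ univ (fun x => u (max x 0)) := by
  have him : (fun x : ℝ => max x 0) '' univ = Ici 0 := by
    ext y
    constructor
    · rintro ⟨x, -, rfl⟩
      simp
    · intro hy
      exact ⟨y, mem_univ _, max_eq_left hy⟩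
  have hc : ConvexOn ℝ univ (fun x : ℝ => max x 0) :=
    (convexOn_id convex_univ).sup (convexOn_const 0 convex_univ)
  exact ConvexOn.comp (g := u) (by rw [him]; exact h.2.1) hc
    (by rw [him]; exact h.1.monotoneOn)

theorem lossF_convex {u1 u2 : ℝ → ℝ} (h1 : Uicx u1) (h2 : Uicx u2) {α : ℝ}
    (hα : α ∈ Ioo (0:ℝ) 1) : ConvexOn ℝ univ (lossF u1 u2 α) := by
  have a := h1.convex_pos.smul hα.1.le
  have b0 : ConvexOn ℝ univ (fun x => u2 (max (-x) 0)) := by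
    simpa [Function.comp_def] using h2.convex_pos.comp_linearMap (-LinearMap.id)
  have b := b0.smul (sub_nonneg.2 hα.2.le)
  exact a.add b

theorem vFun_eq {u1 u2 : ℝ → ℝ} (h1 : Uicx u1) (h2 : Uicx u2) (α x : ℝ) :
    vFun u1 u2 α x = derivWithin (lossF u1 u2 α) (Iic x) x := by
  unfold vFun
  split_ifs with hx
  · have : lossF u1 u2 α =ᶠ[𝓝[Iic x] x] fun y => α * u1 y := by
      filter_upwards [mem_nhdsWithin_of_mem_nhds (Ioi_mem_nhds hx)] with y hy
      have hy : 0 < y := hy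
      simp [lossF, max_eq_left hy.le, max_eq_right (neg_nonpos.2 hy.le), h2.2.2.1]
    rw [this.derivWithin_eq (by simp [lossF, max_eq_left hx.le,
      max_eq_right (neg_nonpos.2 hx.le), h2.2.2.1]), derivWithin_const_mul_field]
  · have hx : x ≤ 0 := not_lt.1 hx
    have : EqOn (lossF u1 u2 α) (fun y => (1 - α) * u2 (-y)) (Iic x) := by
      intro y hy
      have hy : y ≤ 0 := le_trans hy hx
      simp [lossF, max_eq_right hy, max_eq_left (neg_nonneg.2 hy), h1.2.2.1]
    rw [derivWithin_congr this (this (mem_Iic.2 le_rfl)), derivWithin_const_mul_field,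
      derivWithin_comp_neg]
    simp

theorem vFun_hasDeriv {u1 u2 : ℝ → ℝ} (h1 : Uicx u1) (h2 : Uicx u2) {α : ℝ}
    (hα : α ∈ Ioo (0:ℝ) 1) (x : ℝ) :
    HasDerivWithinAt (lossF u1 u2 α) (vFun u1 u2 α x) (Iio x) x := by
  have h := (lossF_convex h1 h2 hα).differentiableWithinAt_Iio_of_mem_interior (x := x) (by simp)
  have h' := h.hasDerivWithinAt.Iic_of_Iio
  rw [vFun_eq h1 h2, h'.derivWithin (uniqueDiffWithinAt_Iic x)]
  exact h.hasDerivWithinAt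

theorem vFun_mono {u1 u2 : ℝ → ℝ} (h1 : Uicx u1) (h2 : Uicx u2) {α : ℝ}
    (hα : α ∈ Ioo (0:ℝ) 1) : Monotone (vFun u1 u2 α) := by
  have h := (lossF_convex h1 h2 hα).monotoneOn_leftDeriv
  have e : ∀ x, derivWithin (lossF u1 u2 α) (Iio x) x = vFun u1 u2 α x := fun x =>
    (vFun_hasDeriv h1 h2 hα x).derivWithin (uniqueDiffWithinAt_Iio x)
  intro x y hxy
  have := h (a := x) (by simp) (b := y) (by simp) hxy
  simpa [e] using this

theorem lossF_subgrad {u1 u2 : ℝ → ℝ} (h1 : Uicx u1) (h2 : Uicx u2) {α : ℝ}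
    (hα : α ∈ Ioo (0:ℝ) 1) (x y : ℝ) :
    lossF u1 u2 α x + vFun u1 u2 α x * (y - x) ≤ lossF u1 u2 α y := by
  have hc := lossF_convex h1 h2 hα
  have hd := vFun_hasDeriv h1 h2 hα x
  have e := hd.derivWithin (uniqueDiffWithinAt_Iio x)
  rcases lt_trichotomy y x with h | h | h
  · have := hc.slope_le_of_hasDerivWithinAt_Iio (mem_univ y) (mem_univ x) h hd
    rw [slope_def_field, div_le_iff₀ (sub_pos.2 h)] at this
    linarith
  · simp [h]
  · have h3 := hc.leftDeriv_le_rightDeriv_of_mem_interior (x := x) (by simp)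
    have h4 := hc.differentiableWithinAt_Ioi_of_mem_interior (x := x) (by simp)
    have h5 := hc.le_slope_of_hasDerivWithinAt_Ioi (mem_univ x) (mem_univ y) h h4.hasDerivWithinAt
    rw [e] at h3
    have h6 := h3.trans h5
    rw [slope_def_field, le_div_iff₀ (sub_pos.2 h)] at h6
    linarith

theorem lossF_measurable {u1 u2 : ℝ → ℝ} (h1 : Uicx u1) (h2 : Uicx u2) (α : ℝ) :
    Measurable (lossF u1 u2 α) :=
  (h1.mono_pos.measurable.const_mul α).add
    ((h2.mono_pos.measurable.comp measurable_neg).const_mul (1 - α))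

theorem BddMeas.mono' {m m' : MeasurableSpace Ω} (h : m ≤ m') {Z : Ω → ℝ} (hZ : BddMeas m Z) :
    BddMeas m' Z := ⟨hZ.1.mono h le_rfl, hZ.2⟩

theorem BddMeas.sub' {m : MeasurableSpace Ω} {Y Z : Ω → ℝ} (hY : BddMeas m Y)
    (hZ : BddMeas m Z) : BddMeas m (fun ω => Y ω - Z ω) := by
  obtain ⟨hY, C, hC⟩ := hY
  obtain ⟨hZ, D, hD⟩ := hZ
  exact ⟨hY.sub hZ, C + D, fun ω => (abs_sub _ _).trans (add_le_add (hC ω) (hD ω))⟩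

theorem BddMeas.min' {m : MeasurableSpace Ω} {Y Z : Ω → ℝ} (hY : BddMeas m Y)
    (hZ : BddMeas m Z) : BddMeas m (fun ω => min (Y ω) (Z ω)) := by
  obtain ⟨hY, C, hC⟩ := hY
  obtain ⟨hZ, D, hD⟩ := hZ
  exact ⟨hY.min hZ, max C D, fun ω => abs_min_le_max_abs_abs.trans (max_le_max (hC ω) (hD ω))⟩

theorem BddMeas.mono_comp {m : MeasurableSpace Ω} {Y : Ω → ℝ} (hY : BddMeas m Y)
    {g : ℝ → ℝ} (hg : Monotone g) : BddMeas m (fun ω => g (Y ω)) := by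
  obtain ⟨hY, C, hC⟩ := hY
  refine ⟨hg.measurable.comp hY, max |g (-C)| |g C|, fun ω => ?_⟩
  exact abs_le_max_abs_abs (hg (abs_le.1 (hC ω)).1) (hg (abs_le.1 (hC ω)).2)

theorem BddMeas.integrable' {mΩ : MeasurableSpace Ω} {P : Measure Ω} [IsProbabilityMeasure P]
    {Y : Ω → ℝ} (hY : BddMeas mΩ Y) : Integrable Y P := by
  obtain ⟨hY, C, hC⟩ := hY
  exact Integrable.of_bound hY.aestronglyMeasurable C (Eventually.of_forall hC)

theorem lossF_integrable {mΩ : MeasurableSpace Ω} {P : Measure Ω} [IsProbabilityMeasure P]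
    {u1 u2 : ℝ → ℝ} (h1 : Uicx u1) (h2 : Uicx u2) (α : ℝ) {Y : Ω → ℝ} (hY : BddMeas mΩ Y) :
    Integrable (fun ω => lossF u1 u2 α (Y ω)) P := by
  have hn : BddMeas mΩ (fun ω => -Y ω) := ⟨hY.1.neg, by simpa using hY.2⟩
  exact ((hY.mono_comp h1.mono_pos).integrable'.const_mul α).add
    ((hn.mono_comp h2.mono_pos).integrable'.const_mul (1 - α))

theorem piRisk_eq {mΩ : MeasurableSpace Ω} {P : Measure Ω} [IsProbabilityMeasure P]
    {u1 u2 : ℝ → ℝ} (h1 : Uicx u1) (h2 : Uicx u2) (α : ℝ) {X Z : Ω → ℝ} (hX : BddMeas mΩ X)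
    (hZ : BddMeas mΩ Z) :
    piRisk P u1 u2 α X Z = ∫ ω, lossF u1 u2 α (X ω - Z ω) ∂P := by
  unfold piRisk lossF
  rw [integral_add, integral_const_mul, integral_const_mul]
  · simp
  · exact ((hX.sub' hZ).mono_comp h1.mono_pos).integrable'.const_mul α
  · have := ((hZ.sub' hX).mono_comp h2.mono_pos).integrable' (P := P)
    simpa using this.const_mul (1 - α)

/-- On every event of the sub-σ-algebra, a minimizer has nonpositive integrated `v`. -/
theorem argmin_setIntegral {mΩ : MeasurableSpace Ω} {P : Measure Ω} [IsProbabilityMeasure P]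
    {𝒢 : MeasurableSpace Ω} (hG : 𝒢 ≤ mΩ) {u1 u2 : ℝ → ℝ} (h1 : Uicx u1) (h2 : Uicx u2)
    {α : ℝ} (hα : α ∈ Ioo (0:ℝ) 1) {X Z : Ω → ℝ} (hX : BddMeas mΩ X)
    (hZ : Z ∈ ArgminSet P 𝒢 u1 u2 α X) {A : Set Ω} (hA : MeasurableSet[𝒢] A) :
    ∫ ω in A, vFun u1 u2 α (X ω - Z ω) ∂P ≤ 0 := by
  obtain ⟨hZb, hmin⟩ := hZ
  set f := lossF u1 u2 α with hf
  set v := vFun u1 u2 α with hv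
  have hZm := hZb.mono' hG
  have hY := hX.sub' hZm
  obtain ⟨C, hC⟩ := hY.2
  have hvm : Monotone v := vFun_mono h1 h2 hα
  let ε : ℕ → ℝ := fun n => 1 / ((n : ℝ) + 1)
  have hε : ∀ n, 0 < ε n := fun n => Nat.one_div_pos_of_nat
  have hε1 : ∀ n, ε n ≤ 1 := fun n => by
    refine (div_le_one (by positivity)).2 ?_
    have : (0 : ℝ) ≤ n := n.cast_nonneg
    linarith
  have hεt : Tendsto ε atTop (𝓝 0) := tendsto_one_div_add_atTop_nhds_zero_nat
  let g : ℕ → Ω → ℝ := fun n ω => (ε n)⁻¹ * (f (X ω - Z ω) - f (X ω - Z ω - ε n))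
  have hYe : ∀ n, BddMeas mΩ (fun ω => X ω - Z ω - ε n) := fun n =>
    hY.sub' ⟨measurable_const, |ε n|, fun _ => le_rfl⟩
  have hgle : ∀ n, ∫ ω in A, g n ω ∂P ≤ 0 := by
    intro n
    have hWb : BddMeas 𝒢 (fun ω => Z ω + A.indicator (fun _ => ε n) ω) := by
      obtain ⟨hZ', D, hD⟩ := hZb
      refine ⟨hZ'.add (measurable_const.indicator hA), D + |ε n|, fun ω => ?_⟩
      refine (abs_add_le _ _).trans (add_le_add (hD ω) ?_)
      by_cases h : ω ∈ A <;> simp [h]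
    have h := hmin _ hWb
    rw [piRisk_eq h1 h2 α hX hZm, piRisk_eq h1 h2 α hX (hWb.mono' hG)] at h
    have i1 : Integrable (fun ω => f (X ω - Z ω)) P := lossF_integrable h1 h2 α hY
    have i2 : Integrable (fun ω => f (X ω - (Z ω + A.indicator (fun _ => ε n) ω))) P :=
      lossF_integrable h1 h2 α (hX.sub' (hWb.mono' hG))
    have h' := sub_nonpos.2 h
    rw [← integral_sub i1 i2] at h'
    have e : (fun ω => f (X ω - Z ω) - f (X ω - (Z ω + A.indicator (fun _ => ε n) ω))) =
        A.indicator (fun ω => f (X ω - Z ω) - f (X ω - Z ω - ε n)) := by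
      funext ω
      by_cases h : ω ∈ A <;> simp [h, sub_sub]
    rw [e, integral_indicator (hG _ hA)] at h'
    change ∫ ω in A, (ε n)⁻¹ * (f (X ω - Z ω) - f (X ω - Z ω - ε n)) ∂P ≤ 0
    rw [integral_const_mul]
    exact mul_nonpos_of_nonneg_of_nonpos (inv_nonneg.2 (hε n).le) h'
  have hlim : Tendsto (fun n => ∫ ω in A, g n ω ∂P) atTop (𝓝 (∫ ω in A, v (X ω - Z ω) ∂P)) := by
    refine tendsto_integral_of_dominated_convergence
      (fun _ => max |v (-C - 1)| |v C|) ?_ (integrable_const _) ?_ ?_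
    · intro n
      have i1 : Integrable (fun ω => f (X ω - Z ω)) P := lossF_integrable h1 h2 α hY
      have i2 : Integrable (fun ω => f (X ω - Z ω - ε n)) P := lossF_integrable h1 h2 α (hYe n)
      exact ((i1.sub i2).const_mul _).aestronglyMeasurable.restrict
    · intro n
      refine Eventually.of_forall fun ω => ?_
      have hω := abs_le.1 (hC ω)
      have s1 := lossF_subgrad h1 h2 hα (X ω - Z ω) (X ω - Z ω - ε n)
      have s2 := lossF_subgrad h1 h2 hα (X ω - Z ω - ε n) (X ω - Z ω)
      rw [← hf, ← hv] at s1 s2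
      have m1 : v (-C - 1) ≤ v (X ω - Z ω - ε n) := hvm (by linarith [hε1 n])
      have m2 : v (X ω - Z ω) ≤ v C := hvm hω.2
      have hgω : g n ω = (f (X ω - Z ω) - f (X ω - Z ω - ε n)) / ε n := by
        simp only [g]; rw [mul_comm, div_eq_mul_inv]
      rw [Real.norm_eq_abs]
      refine abs_le_max_abs_abs (m1.trans ?_) (le_trans ?_ m2)
      · rw [hgω, le_div_iff₀ (hε n)]
        linarith
      · rw [hgω, div_le_iff₀ (hε n)]
        linarith
    · refine Eventually.of_forall fun ω => ?_
      have hd := vFun_hasDeriv h1 h2 hα (X ω - Z ω)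
      rw [hasDerivWithinAt_iff_tendsto_slope' (by simp)] at hd
      have ht : Tendsto (fun n => X ω - Z ω - ε n) atTop (𝓝[<] (X ω - Z ω)) := by
        refine tendsto_nhdsWithin_iff.2 ⟨?_, Eventually.of_forall fun n => ?_⟩
        · simpa using hεt.const_sub (X ω - Z ω)
        · have := hε n
          simp only [mem_Iio]
          linarith
      refine (hd.comp ht).congr fun n => ?_
      simp only [Function.comp, slope_def_field, g, ← hf]
      have := (hε n).ne'
      field_simp
      rw [show X ω - Z ω - ε n - (X ω - Z ω) = -ε n by ring]
      field_simp
      ring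
  exact le_of_tendsto' hlim hgle

theorem argmin_subset_shortfall {mΩ : MeasurableSpace Ω} {P : Measure Ω} [IsProbabilityMeasure P]
    {𝒢 : MeasurableSpace Ω} (hG : 𝒢 ≤ mΩ) {u1 u2 : ℝ → ℝ} (h1 : Uicx u1) (h2 : Uicx u2)
    {α : ℝ} (hα : α ∈ Ioo (0:ℝ) 1) {X : Ω → ℝ} (hX : BddMeas mΩ X) :
    ArgminSet P 𝒢 u1 u2 α X ⊆ ShortfallSet P 𝒢 (vFun u1 u2 α) X := by
  intro Z hZ
  refine ⟨hZ.1, ?_⟩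
  set c := P[fun ω' => vFun u1 u2 α (X ω' - Z ω')|𝒢] with hc
  have hcm : Measurable[𝒢] c := stronglyMeasurable_condExp.measurable
  have hA : MeasurableSet[𝒢] {ω | 0 < c ω} := measurableSet_lt measurable_const hcm
  have hvi : Integrable (fun ω' => vFun u1 u2 α (X ω' - Z ω')) P :=
    ((hX.sub' (hZ.1.mono' hG)).mono_comp (vFun_mono h1 h2 hα)).integrable'
  have h := argmin_setIntegral hG h1 h2 hα hX hZ hA
  rw [← setIntegral_condExp hG hvi hA, ← hc, ← integral_indicator (hG _ hA)] at h
  have hnn : 0 ≤ {ω | 0 < c ω}.indicator c := indicator_nonneg fun ω hω => le_of_lt hω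
  have h0 := le_antisymm h (integral_nonneg hnn)
  rw [integral_eq_zero_iff_of_nonneg hnn (integrable_condExp.indicator (hG _ hA))] at h0
  filter_upwards [h0] with ω hω
  by_contra hlt
  have hlt : 0 < c ω := not_le.1 hlt
  have : c ω = 0 := by simpa [indicator, hlt] using hω
  linarith

theorem min_mem_argmin {mΩ : MeasurableSpace Ω} {P : Measure Ω} [IsProbabilityMeasure P]
    {𝒢 : MeasurableSpace Ω} (hG : 𝒢 ≤ mΩ) {u1 u2 : ℝ → ℝ} (h1 : Uicx u1) (h2 : Uicx u2)
    {α : ℝ} (hα : α ∈ Ioo (0:ℝ) 1) {X Z Z0 : Ω → ℝ} (hX : BddMeas mΩ X)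
    (hZ0 : Z0 ∈ ArgminSet P 𝒢 u1 u2 α X)
    (hZ : Z ∈ ShortfallSet P 𝒢 (vFun u1 u2 α) X) :
    (fun ω => min (Z ω) (Z0 ω)) ∈ ArgminSet P 𝒢 u1 u2 α X := by
  have hWb := hZ.1.min' hZ0.1
  refine ⟨hWb, fun W hW => le_trans ?_ (hZ0.2 W hW)⟩
  rw [piRisk_eq h1 h2 α hX (hWb.mono' hG), piRisk_eq h1 h2 α hX (hZ0.1.mono' hG)]
  set f := lossF u1 u2 α with hf
  let V : Ω → ℝ := fun ω => vFun u1 u2 α (X ω - Z ω)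
  let H : Ω → ℝ := fun ω => min (Z ω - Z0 ω) 0
  have hHb : BddMeas 𝒢 H := (hZ.1.sub' hZ0.1).min' ⟨measurable_const, 0, fun _ => by simp⟩
  have hVi : Integrable V P :=
    ((hX.sub' (hZ.1.mono' hG)).mono_comp (vFun_mono h1 h2 hα)).integrable'
  have hVH : Integrable (V * H) P := by
    obtain ⟨hHm, D, hD⟩ := hHb
    exact hVi.mul_bdd (c := D) ((hHm.mono hG le_rfl).aestronglyMeasurable) (Eventually.of_forall hD)
  have hce : P[V * H|𝒢] =ᵐ[P] P[V|𝒢] * H :=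
    condExp_mul_of_stronglyMeasurable_right hHb.1.stronglyMeasurable hVH hVi
  have hpos : 0 ≤ ∫ ω, (V * H) ω ∂P := by
    rw [← integral_condExp hG]
    refine integral_nonneg_of_ae ?_
    filter_upwards [hce, hZ.2] with ω h3 h4
    rw [h3]
    exact mul_nonneg_of_nonpos_of_nonpos h4 (min_le_right _ _)
  have i1 : Integrable (fun ω => f (X ω - min (Z ω) (Z0 ω))) P :=
    lossF_integrable h1 h2 α (hX.sub' (hWb.mono' hG))
  have i2 : Integrable (fun ω => f (X ω - Z0 ω)) P :=
    lossF_integrable h1 h2 α (hX.sub' (hZ0.1.mono' hG))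
  have key : ∫ ω, (f (X ω - min (Z ω) (Z0 ω)) + (V * H) ω) ∂P ≤ ∫ ω, f (X ω - Z0 ω) ∂P := by
    refine integral_mono (i1.add hVH) i2 fun ω => ?_
    simp only [Pi.mul_apply, V, H]
    rcases le_total (Z ω) (Z0 ω) with h | h
    · rw [min_eq_left h, min_eq_left (sub_nonpos.2 h)]
      have := lossF_subgrad h1 h2 hα (X ω - Z ω) (X ω - Z0 ω)
      rwa [show X ω - Z0 ω - (X ω - Z ω) = Z ω - Z0 ω by ring] at this
    · rw [min_eq_right h, min_eq_right (sub_nonneg.2 h)]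
      simp
  rw [integral_add i1 hVH] at key
  linarith

/-- Theorem 4.1 (i): the conditional generalized quantile coincides a.s.
with the conditional shortfall risk measure associated with
`v(x) = α·(u1)'_−(x)` for `x > 0`, `v(x) = −(1−α)·(u2)'_+(−x)` for `x ≤ 0`. -/
theorem conditional_generalized_quantile_eq_shortfall
    [mΩ : MeasurableSpace Ω] (P : Measure Ω) [IsProbabilityMeasure P]
    (hP : Nonatomic P) (𝒢 : MeasurableSpace Ω) (hG : 𝒢 ≤ mΩ)
    {u1 u2 : ℝ → ℝ} (h1 : Uicx u1) (h2 : Uicx u2)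
    {α : ℝ} (hα : α ∈ Set.Ioo (0:ℝ) 1)
    (X : Ω → ℝ) (hX : BddMeas mΩ X)
    (ρa ρv : Ω → ℝ)
    (hρa : IsEssInf P (ArgminSet P 𝒢 u1 u2 α X) ρa)
    (hρv : IsEssInf P (ShortfallSet P 𝒢 (vFun u1 u2 α) X) ρv) :
    ρa =ᵐ[P] ρv := by
  have hsub := argmin_subset_shortfall (P := P) hG h1 h2 hα hX
  have hne : (ArgminSet P 𝒢 u1 u2 α X).Nonempty := by
    by_contra hcon
    rw [not_nonempty_iff_eq_empty] at hcon
    have h := hρa.2 (fun ω => ρa ω + 1) (by simp [hcon])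
    have hF : ∀ᵐ ω ∂P, False := by
      filter_upwards [h] with ω hω
      linarith
    have := hF.exists
    simp at this
  obtain ⟨Z0, hZ0⟩ := hne
  have hle : ρa ≤ᵐ[P] ρv := by
    refine hρv.2 ρa fun Z hZ => ?_
    filter_upwards [hρa.1 _ (min_mem_argmin hG h1 h2 hα hX hZ0 hZ)] with ω hω
    exact hω.trans (min_le_left _ _)
  have hge : ρv ≤ᵐ[P] ρa := hρa.2 ρv fun Z hZ => hρv.1 Z (hsub hZ)
  filter_upwards [hle, hge] with ω h3 h4
  exact le_antisymm h3 h4
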